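/- arXiv:2309.16998 — 13 statements merged into one kernel-verified Lean document; each statement's English description precedes it below -/
import Mathlib

section
/- Let n ≥ 1 and let L be a subalgebra of PŁ_n (including the case L = {0,…,n}). Every congruence of L, i.e., every equivalence relation θ on L such that (a,b) ∈ θ and (c,d) ∈ θ imply (a ∗ c, b ∗ d) ∈ θ for each operation ∗ ∈ {∧, ∨, ⊙, ⊕}, is either the identity relation on L or the full relation L × L. In other words, every subalgebra of PŁ_n is simple. -/
/-- Truncated product on the positive MV-chain `{0,…,n}`:
`x ⊙ y = max (0, x + y - n)` (ℕ-subtraction is truncated). -/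
def plOdot (n x y : ℕ) : ℕ := x + y - n

/-- Truncated sum on the positive MV-chain `{0,…,n}`: `x ⊕ y = min (n, x + y)`. -/
def plOplus (n x y : ℕ) : ℕ := min n (x + y)

/-- `L` is a subalgebra of the positive MV-chain `PŁ_n`: a subset of `{0,…,n}`
containing `0` and `n` and closed under `∧, ∨, ⊙, ⊕`. -/
def IsSubalg (n : ℕ) (L : Set ℕ) : Prop :=
  (∀ x ∈ L, x ≤ n) ∧ 0 ∈ L ∧ n ∈ L ∧
  (∀ x ∈ L, ∀ y ∈ L, min x y ∈ L) ∧
  (∀ x ∈ L, ∀ y ∈ L, max x y ∈ L) ∧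
  (∀ x ∈ L, ∀ y ∈ L, plOdot n x y ∈ L) ∧
  (∀ x ∈ L, ∀ y ∈ L, plOplus n x y ∈ L)

/-- `R` is a subalgebra of `PŁ_n × PŁ_n` (componentwise operations). -/
def IsSubalgPair (n : ℕ) (R : Set (ℕ × ℕ)) : Prop :=
  (∀ p ∈ R, p.1 ≤ n ∧ p.2 ≤ n) ∧ (0, 0) ∈ R ∧ (n, n) ∈ R ∧
  (∀ p ∈ R, ∀ q ∈ R, (min p.1 q.1, min p.2 q.2) ∈ R) ∧
  (∀ p ∈ R, ∀ q ∈ R, (max p.1 q.1, max p.2 q.2) ∈ R) ∧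
  (∀ p ∈ R, ∀ q ∈ R, (plOdot n p.1 q.1, plOdot n p.2 q.2) ∈ R) ∧
  (∀ p ∈ R, ∀ q ∈ R, (plOplus n p.1 q.1, plOplus n p.2 q.2) ∈ R)

/-- A relation on `{0,…,n}` preserved by `x ↦ x ⊙ x` which relates some `c < n` to `n`
relates `0` to `n`. -/
theorem rel_zero_top_of_rel_top {n : ℕ} {P : ℕ → ℕ → Prop}
    (hodot : ∀ a b, P a b → P (plOdot n a a) (plOdot n b b)) :
    ∀ c, c < n → P c n → P 0 n := by
  intro c
  induction c using Nat.strong_induction_on with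
  | _ c ih =>
    intro hc h
    rcases Nat.eq_zero_or_pos c with rfl | hpos
    · exact h
    · have h' := hodot c n h
      simp only [plOdot, Nat.add_sub_cancel] at h'
      exact ih (c + c - n) (by omega) (by omega) h'

/-- A relation on `{0,…,n}` preserved by `x ↦ x ⊙ x` and `x ↦ x ⊕ x` which relates some
`a < b` relates `0` to `n`. -/
theorem rel_zero_top_of_rel_lt {n : ℕ} {P : ℕ → ℕ → Prop}
    (hodot : ∀ a b, P a b → P (plOdot n a a) (plOdot n b b))
    (hoplus : ∀ a b, P a b → P (plOplus n a a) (plOplus n b b))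
    (a b : ℕ) (hab : a < b) (hb : b ≤ n) (h : P a b) : P 0 n := by
  induction hk : n - (b - a) using Nat.strong_induction_on generalizing a b with
  | _ k ih =>
    rcases hb.eq_or_lt with rfl | hbn
    · exact rel_zero_top_of_rel_top hodot a hab h
    rcases le_or_gt n (a + a) with ha | ha
    · exact ih _ (by simp only [plOdot]; omega) _ _ (by simp only [plOdot]; omega)
        (by simp only [plOdot]; omega) (hodot a b h) rfl
    rcases le_total (b + b) n with hb' | hb'
    · have h' := hoplus a b h
      rw [plOplus, plOplus, min_eq_right ha.le, min_eq_right hb'] at h'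
      exact ih _ (by omega) _ _ (by omega) hb' h' rfl
    · have h' := hoplus a b h
      rw [plOplus, plOplus, min_eq_right ha.le, min_eq_left hb'] at h'
      exact rel_zero_top_of_rel_top hodot (a + a) ha h'

/-- every subalgebra of `PŁ_n` is simple, i.e. every congruence on it
is the identity relation or the full relation. -/
theorem subalgebras_simple (n : ℕ) (hn : 1 ≤ n) (L : Set ℕ) (hL : IsSubalg n L)
    (θ : ℕ → ℕ → Prop)
    (hrefl : ∀ a ∈ L, θ a a)
    (hsymm : ∀ a ∈ L, ∀ b ∈ L, θ a b → θ b a)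
    (htrans : ∀ a ∈ L, ∀ b ∈ L, ∀ c ∈ L, θ a b → θ b c → θ a c)
    (hmin : ∀ a ∈ L, ∀ b ∈ L, ∀ c ∈ L, ∀ d ∈ L,
      θ a b → θ c d → θ (min a c) (min b d))
    (hmax : ∀ a ∈ L, ∀ b ∈ L, ∀ c ∈ L, ∀ d ∈ L,
      θ a b → θ c d → θ (max a c) (max b d))
    (hodot : ∀ a ∈ L, ∀ b ∈ L, ∀ c ∈ L, ∀ d ∈ L,
      θ a b → θ c d → θ (plOdot n a c) (plOdot n b d))
    (hoplus : ∀ a ∈ L, ∀ b ∈ L, ∀ c ∈ L, ∀ d ∈ L,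
      θ a b → θ c d → θ (plOplus n a c) (plOplus n b d)) :
    (∀ a ∈ L, ∀ b ∈ L, θ a b → a = b) ∨ (∀ a ∈ L, ∀ b ∈ L, θ a b) := by
  obtain ⟨hle, h0, hn', -, -, hLodot, hLoplus⟩ := hL
  by_cases hid : ∀ a ∈ L, ∀ b ∈ L, θ a b → a = b
  · exact Or.inl hid
  right
  push Not at hid
  obtain ⟨a, ha, b, hb, hab, hne⟩ := hid
  have key : ∀ a ∈ L, ∀ b ∈ L, θ a b → a < b → θ 0 n := fun a ha b hb hab hlt =>
    (rel_zero_top_of_rel_lt (P := fun x y => x ∈ L ∧ y ∈ L ∧ θ x y)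
      (fun x y ⟨hx, hy, h⟩ =>
        ⟨hLodot x hx x hx, hLodot y hy y hy, hodot x hx y hy x hx y hy h h⟩)
      (fun x y ⟨hx, hy, h⟩ =>
        ⟨hLoplus x hx x hx, hLoplus y hy y hy, hoplus x hx y hy x hx y hy h h⟩)
      a b hlt (hle b hb) ⟨ha, hb, hab⟩).2.2
  have h0n : θ 0 n := hne.lt_or_gt.elim (key a ha b hb hab)
    (key b hb a ha (hsymm a ha b hb hab))
  have hzero : ∀ x ∈ L, θ 0 x := fun x hx => by
    simpa [hle x hx] using hmin 0 h0 n hn' x hx x hx h0n (hrefl x hx)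
  exact fun x hx y hy =>
    htrans x hx 0 h0 y hy (hsymm 0 h0 x hx (hzero x hx)) (hzero y hy)
end

section
/- Let n ≥ 1, let L be a subalgebra of PŁ_n, and let h : L → {0, …, n} be a map with h(0) = 0, h(n) = n, and h(a ∗ b) = h(a) ∗ h(b) for all a, b ∈ L and each operation ∗ ∈ {∧, ∨, ⊙, ⊕} (i.e., h is a homomorphism from L to PŁ_n). Then h(s) = s for every s ∈ L; that is, the only homomorphism from a subalgebra of PŁ_n to PŁ_n is the inclusion. -/
/-- the only homomorphism from a subalgebra of `PŁ_n` to `PŁ_n`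
is the inclusion. -/
theorem hom_from_subalgebra_is_inclusion (n : ℕ) (hn : 1 ≤ n)
    (L : Set ℕ) (hL : IsSubalg n L) (h : ℕ → ℕ)
    (hrange : ∀ a ∈ L, h a ≤ n)
    (h0 : h 0 = 0) (hN : h n = n)
    (hmin : ∀ a ∈ L, ∀ b ∈ L, h (min a b) = min (h a) (h b))
    (hmax : ∀ a ∈ L, ∀ b ∈ L, h (max a b) = max (h a) (h b))
    (hodot : ∀ a ∈ L, ∀ b ∈ L, h (plOdot n a b) = plOdot n (h a) (h b))
    (hoplus : ∀ a ∈ L, ∀ b ∈ L, h (plOplus n a b) = plOplus n (h a) (h b)) :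
    ∀ s ∈ L, h s = s := by
  obtain ⟨hle, -, -, -, -, hod, hop⟩ := hL
  by_contra! hne
  -- Doubling a point moved by `h` yields a point moved at least one step further.
  have moved_further : ∀ k : ℕ, ∃ s ∈ L, (k : ℤ) < |(h s : ℤ) - s| := by
    intro k
    induction k with
    | zero =>
      obtain ⟨s, hs, hne⟩ := hne
      exact ⟨s, hs, by simpa [sub_eq_zero] using hne⟩
    | succ k ih =>
      obtain ⟨s, hs, hk⟩ := ih
      have hsum := hoplus s hs s hs
      have hprod := hodot s hs s hs
      have hs_le := hle s hs
      have hhs_le := hrange s hs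
      rcases le_total (2 * s) n with h1 | h1 <;> rcases le_total (2 * h s) n with h2 | h2
      · refine ⟨_, hop s hs s hs, ?_⟩
        rw [hsum]
        unfold plOplus
        grind
      · have hzero : plOdot n s s = 0 := by unfold plOdot; omega
        rw [hzero, h0] at hprod
        refine ⟨_, hop s hs s hs, ?_⟩
        rw [hsum]
        unfold plOplus
        unfold plOdot at hprod
        grind
      · have htop : plOplus n s s = n := by unfold plOplus; omega
        rw [htop, hN] at hsum
        refine ⟨_, hod s hs s hs, ?_⟩
        rw [hprod]
        unfold plOdot
        unfold plOplus at hsum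
        grind
      · refine ⟨_, hod s hs s hs, ?_⟩
        rw [hprod]
        unfold plOdot
        grind
  obtain ⟨s, hs, hk⟩ := moved_further n
  have hs_le := hle s hs
  have hhs_le := hrange s hs
  grind
end

section
/- Let n ≥ 1 and let R be a subalgebra of PŁ_n × PŁ_n. If R is not contained in the relation ≤ and not contained in its converse ≥, then R equals the direct product pr₁(R) × pr₂(R) of its two coordinate projections (each of which is a subalgebra of PŁ_n). Equivalently, every subalgebra of PŁ_n × PŁ_n which is not a direct product of two subalgebras of PŁ_n is contained in ≤ or in ≥. -/
theorem IsSubalgPair.preimage_swap {n : ℕ} {R : Set (ℕ × ℕ)} (hR : IsSubalgPair n R) :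
    IsSubalgPair n (Prod.swap ⁻¹' R) := by
  obtain ⟨hle, h0, hn, hmin, hmax, hodot, hoplus⟩ := hR
  exact ⟨fun p hp => (hle _ hp).symm, h0, hn, fun p hp q hq => hmin _ hp _ hq,
    fun p hp q hq => hmax _ hp _ hq, fun p hp q hq => hodot _ hp _ hq,
    fun p hp q hq => hoplus _ hp _ hq⟩

theorem IsSubalgPair.isSubalg_image_fst {n : ℕ} {R : Set (ℕ × ℕ)} (hR : IsSubalgPair n R) :
    IsSubalg n (Prod.fst '' R) := by
  obtain ⟨hle, h0, hn, hmin, hmax, hodot, hoplus⟩ := hR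
  refine ⟨?_, ⟨_, h0, rfl⟩, ⟨_, hn, rfl⟩, ?_, ?_, ?_, ?_⟩
  · rintro _ ⟨p, hp, rfl⟩
    exact (hle p hp).1
  all_goals rintro _ ⟨p, hp, rfl⟩ _ ⟨q, hq, rfl⟩
  · exact ⟨_, hmin p hp q hq, rfl⟩
  · exact ⟨_, hmax p hp q hq, rfl⟩
  · exact ⟨_, hodot p hp q hq, rfl⟩
  · exact ⟨_, hoplus p hp q hq, rfl⟩

theorem IsSubalgPair.isSubalg_image_snd {n : ℕ} {R : Set (ℕ × ℕ)} (hR : IsSubalgPair n R) :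
    IsSubalg n (Prod.snd '' R) := by
  have h := hR.preimage_swap.isSubalg_image_fst
  rwa [← Set.image_swap_eq_preimage_swap, Set.image_image] at h

/-- Iterating `x ⊕ x` and `x ⊙ x` enlarges the gap between two distinct coordinates until the
pair becomes `(n, 0)`. -/
theorem IsSubalgPair.top_bot_mem_of_lt {n : ℕ} {R : Set (ℕ × ℕ)} (hR : IsSubalgPair n R)
    {a b : ℕ} (hab : (a, b) ∈ R) (hlt : b < a) : (n, 0) ∈ R := by
  obtain ⟨hle, -, -, -, -, hodot, hoplus⟩ := hR
  have dbl_oplus (a b : ℕ) (h : (a, b) ∈ R) : (min n (a + a), min n (b + b)) ∈ R :=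
    hoplus _ h _ h
  have dbl_odot (a b : ℕ) (h : (a, b) ∈ R) : (a + a - n, b + b - n) ∈ R :=
    hodot _ h _ h
  induction hk : n - (a - b) using Nat.strong_induction_on generalizing a b with
  | _ k ih =>
    obtain ⟨ha, hb⟩ : a ≤ n ∧ b ≤ n := hle _ hab
    have step (c d : ℕ) (hcd : (c, d) ∈ R) (h : a + d < c + b) : (n, 0) ∈ R := by
      have hc : c ≤ n := (hle _ hcd).1
      exact ih _ (by omega) hcd (by omega) rfl
    have h_oplus := dbl_oplus a b hab
    by_cases hsum : a + b < n
    · exact step _ _ h_oplus (by omega)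
    by_cases hsum' : n < a + b
    · exact step _ _ (dbl_odot a b hab) (by omega)
    by_cases hb0 : b = 0
    · obtain rfl : a = n := by omega
      rwa [hb0] at hab
    · exact step _ _ (dbl_odot _ _ h_oplus) (by omega)

/-- a subalgebra of `PŁ_n × PŁ_n` contained neither in `≤` nor in `≥`
is the direct product of its two projections (which are subalgebras of `PŁ_n`). -/
theorem subalgebra_of_square_not_in_order (n : ℕ) (hn : 1 ≤ n)
    (R : Set (ℕ × ℕ)) (hR : IsSubalgPair n R)
    (h1 : ¬ R ⊆ {p : ℕ × ℕ | p.1 ≤ p.2})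
    (h2 : ¬ R ⊆ {p : ℕ × ℕ | p.2 ≤ p.1}) :
    IsSubalg n (Prod.fst '' R) ∧ IsSubalg n (Prod.snd '' R) ∧
    R = (Prod.fst '' R) ×ˢ (Prod.snd '' R) := by
  have htop : (n, 0) ∈ R := by
    obtain ⟨⟨a, b⟩, hab, hlt⟩ := Set.not_subset.mp h1
    exact hR.top_bot_mem_of_lt hab (not_le.mp hlt)
  have hbot : (0, n) ∈ R := by
    obtain ⟨⟨a, b⟩, hab, hlt⟩ := Set.not_subset.mp h2
    exact hR.preimage_swap.top_bot_mem_of_lt (a := b) (b := a) hab (not_le.mp hlt)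
  refine ⟨hR.isSubalg_image_fst, hR.isSubalg_image_snd, Set.Subset.antisymm
    (fun p hp => ⟨⟨p, hp, rfl⟩, ⟨p, hp, rfl⟩⟩) ?_⟩
  rintro ⟨_, _⟩ ⟨⟨p, hp, rfl⟩, ⟨q, hq, rfl⟩⟩
  obtain ⟨hle, -, -, hmin, hmax, -, -⟩ := hR
  simpa [(hle p hp).1, (hle q hq).2] using
    hmax _ (hmin p hp _ htop) _ (hmin q hq _ hbot)
end

section
/- Let n ≥ 1 and let R be a subalgebra of PŁ_n × PŁ_n with R ⊆ ≤, and suppose R contains some pair (x,y) with x ≠ y (i.e., R is not the diagonal of a subalgebra of PŁ_n). Put S = pr₁(R) × pr₂(R). Then ⊲ ∩ S ⊆ R ⊆ ≤ ∩ S. -/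
/-- A pair `(0, z)` with `0 < z` generates `(0, n)` by repeated doubling. -/
theorem IsSubalgPair.zero_top_mem_of_zero_fst {n : ℕ} {R : Set (ℕ × ℕ)} (hR : IsSubalgPair n R)
    {z : ℕ} (hz : 0 < z) (h : (0, z) ∈ R) : (0, n) ∈ R := by
  obtain ⟨hbd, -, -, -, -, -, hplus⟩ := hR
  induction hk : n - z using Nat.strong_induction_on generalizing z with
  | _ k ih =>
    have hzn : z ≤ n := (hbd _ h).2
    rcases hzn.eq_or_lt with rfl | hlt
    · exact h
    · have h2 : (0, min n (z + z)) ∈ R := by simpa [plOplus] using hplus _ h _ h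
      exact ih (n - min n (z + z)) (by omega) (by omega) h2 rfl

/-- A pair `(x, y)` with `x < y` generates `(0, n)`: either `x ⊙ x = 0 < y ⊙ y`, or one of
`⊕`, `⊙` doubles the distance between the coordinates. -/
theorem IsSubalgPair.zero_top_mem_of_lt {n : ℕ} {R : Set (ℕ × ℕ)} (hR : IsSubalgPair n R)
    {x y : ℕ} (hxy : x < y) (h : (x, y) ∈ R) : (0, n) ∈ R := by
  have hR' := hR
  obtain ⟨hbd, -, -, -, -, hdot, hplus⟩ := hR'
  induction hk : n - (y - x) using Nat.strong_induction_on generalizing x y with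
  | _ k ih =>
    have hyn : y ≤ n := (hbd _ h).2
    have hd : (x + x - n, y + y - n) ∈ R := hdot _ h _ h
    have hp : (min n (x + x), min n (y + y)) ∈ R := hplus _ h _ h
    by_cases hy : y + y ≤ n
    · exact ih _ (by omega) (by omega) hp rfl
    by_cases hx : x + x ≤ n
    · rw [Nat.sub_eq_zero_of_le hx] at hd
      exact hR.zero_top_mem_of_zero_fst (by omega) hd
    · exact ih _ (by omega) (by omega) hd rfl

/-- a non-diagonal subalgebra `R ⊆ ≤` of `PŁ_n × PŁ_n` satisfies
`⊲ ∩ S ⊆ R ⊆ ≤ ∩ S` where `S = pr₁(R) × pr₂(R)`. -/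
theorem nondiagonal_subalgebra_between (n : ℕ) (hn : 1 ≤ n)
    (R : Set (ℕ × ℕ)) (hR : IsSubalgPair n R)
    (hle : R ⊆ {p : ℕ × ℕ | p.1 ≤ p.2})
    (hnd : ∃ p ∈ R, p.1 ≠ p.2) :
    {p : ℕ × ℕ | p.1 = 0 ∨ p.2 = n} ∩ ((Prod.fst '' R) ×ˢ (Prod.snd '' R)) ⊆ R ∧
    R ⊆ {p : ℕ × ℕ | p.1 ≤ p.2} ∩ ((Prod.fst '' R) ×ˢ (Prod.snd '' R)) := by
  obtain ⟨⟨x, y⟩, hxy, hne⟩ := hnd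
  have h0n : (0, n) ∈ R := hR.zero_top_mem_of_lt (lt_of_le_of_ne (hle hxy) hne) hxy
  obtain ⟨hbd, -, -, hmin, hmax, -, -⟩ := hR
  refine ⟨?_, fun p hp => ⟨hle hp, ⟨p, hp, rfl⟩, ⟨p, hp, rfl⟩⟩⟩
  rintro ⟨a, b⟩ ⟨hab, ⟨⟨a', c⟩, hac, rfl⟩, ⟨⟨d, b'⟩, hdb, rfl⟩⟩
  rcases hab with h | h
  · have hb : b' ≤ n := (hbd _ hdb).2
    simp only at h
    subst h
    simpa [hb] using hmin _ h0n _ hdb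
  · have hc : c ≤ n := (hbd _ hac).2
    simp only at h
    subst h
    simpa [hc] using hmax _ h0n _ hac
end

section
/- Let n ≥ 1 and let R be a subalgebra of PŁ_n × PŁ_n with R ⊆ ≤, containing some pair (x,y) with x ≠ y, and suppose pr₁(R) = PŁ_k = {0, ℓ, 2ℓ, …, n} where n = k·ℓ, and pr₂(R) = PŁ_{k'} is a subalgebra of PŁ_n; set S = PŁ_k × PŁ_{k'}. For each i ∈ {0, 1, …, k}, let y_i be the least element of PŁ_{k'} with (iℓ, y_i) ∈ R. Then y_0 = 0, y_k = n, and R = ⋃_{i=0}^{k} C_{(iℓ, y_i),S}. -/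
namespace IsSubalgPair

variable {n : ℕ} {R : Set (ℕ × ℕ)}

theorem bot_top_mem_of_mem_top (hR : IsSubalgPair n R) {x : ℕ} (hx : x < n)
    (hmem : (x, n) ∈ R) : (0, n) ∈ R := by
  induction x using Nat.strong_induction_on with
  | _ x ih =>
    rcases Nat.eq_zero_or_pos x with rfl | hpos
    · exact hmem
    · obtain ⟨-, -, -, -, -, hodot, -⟩ := hR
      have h := hodot _ hmem _ hmem
      simp only [plOdot, Nat.add_sub_cancel] at h
      exact ih (x + x - n) (by omega) (by omega) h

/-- Doubling by `⊕` or `⊙` widens the gap of a non-diagonal pair until it is `(0, n)`. -/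
theorem bot_top_mem (hR : IsSubalgPair n R) {x y : ℕ} (hxy : x < y)
    (hmem : (x, y) ∈ R) : (0, n) ∈ R := by
  induction hd : n - (y - x) using Nat.strong_induction_on generalizing x y with
  | _ d ih =>
    obtain ⟨hbound, -, -, -, -, hodot, hoplus⟩ := id hR
    have hyn : y ≤ n := (hbound _ hmem).2
    by_cases hy : y + y ≤ n
    · have h := hoplus _ hmem _ hmem
      simp only [plOplus, min_eq_right hy, min_eq_right (show x + x ≤ n by omega)] at h
      exact ih _ (by omega) (by omega) h rfl
    · by_cases hx : n ≤ x + x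
      · have h := hodot _ hmem _ hmem
        simp only [plOdot] at h
        exact ih _ (by omega) (by omega) h rfl
      · have h := hoplus _ hmem _ hmem
        simp only [plOplus, min_eq_left (show n ≤ y + y by omega),
          min_eq_right (show x + x ≤ n by omega)] at h
        exact hR.bot_top_mem_of_mem_top (by omega) h

theorem mem_of_le_of_le (hR : IsSubalgPair n R) (hbt : (0, n) ∈ R) {a b x z : ℕ}
    (hab : (a, b) ∈ R) (hx : x ∈ Prod.fst '' R) (hz : z ∈ Prod.snd '' R)
    (hxa : x ≤ a) (hbz : b ≤ z) : (x, z) ∈ R := by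
  obtain ⟨hbound, -, -, hmin, hmax, -, -⟩ := hR
  obtain ⟨⟨x, u⟩, hxu, rfl⟩ := hx
  obtain ⟨⟨w, z⟩, hwz, rfl⟩ := hz
  have hxn := hmax _ hxu _ hbt
  have h0z := hmin _ hwz _ hbt
  have hu : u ≤ n := (hbound _ hxu).2
  have hz : z ≤ n := (hbound _ hwz).2
  have hb : b ≤ n := (hbound _ hab).2
  simp only [Nat.max_zero, Nat.min_zero, max_eq_right hu, min_eq_left hz] at hxn h0z
  have hxb := hmin _ hab _ hxn
  simp only [min_eq_right hxa, min_eq_left hb] at hxb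
  have h := hmax _ hxb _ h0z
  simpa only [Nat.max_zero, max_eq_right hbz] using h

end IsSubalgPair

/-- a non-diagonal subalgebra `R ⊆ ≤` with `pr₁(R) = PŁ_k` and
`pr₂(R) = PŁ_{k'}` is the union of the rectangles `C_{(iℓ, y_i), S}` where `y_i`
is the least element of `pr₂(R)` with `(iℓ, y_i) ∈ R`; moreover `y_0 = 0`, `y_k = n`. -/
theorem subalgebra_is_union_of_rectangles (n : ℕ) (hn : 1 ≤ n) (k ℓ : ℕ)
    (hkl : n = k * ℓ)
    (R : Set (ℕ × ℕ)) (hR : IsSubalgPair n R)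
    (hle : R ⊆ {p : ℕ × ℕ | p.1 ≤ p.2})
    (hnd : ∃ p ∈ R, p.1 ≠ p.2)
    (hpr1 : Prod.fst '' R = {m : ℕ | ∃ i ≤ k, m = i * ℓ})
    (L' : Set ℕ) (hL' : IsSubalg n L') (hpr2 : Prod.snd '' R = L')
    (y : ℕ → ℕ)
    (hy : ∀ i ≤ k, y i ∈ L' ∧ (i * ℓ, y i) ∈ R ∧
      ∀ z ∈ L', (i * ℓ, z) ∈ R → y i ≤ z) :
    y 0 = 0 ∧ y k = n ∧
    R = {p : ℕ × ℕ | ∃ i ≤ k,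
      p ∈ (Prod.fst '' R) ×ˢ (Prod.snd '' R) ∧ p.1 ≤ i * ℓ ∧ y i ≤ p.2} := by
  have hbt : (0, n) ∈ R := by
    obtain ⟨p, hp, hne⟩ := hnd
    exact hR.bot_top_mem (lt_of_le_of_ne (hle hp) hne) hp
  refine ⟨?_, ?_, ?_⟩
  · have h := (hy 0 (Nat.zero_le k)).2.2 0 hL'.2.1
    rw [Nat.zero_mul] at h
    exact Nat.le_zero.mp (h hR.2.1)
  · obtain ⟨hyL, hyR, -⟩ := hy k le_rfl
    rw [← hkl] at hyR
    exact le_antisymm (hL'.1 _ hyL) (hle hyR)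
  · ext ⟨x, z⟩
    constructor
    · intro hp
      have hx : x ∈ Prod.fst '' R := ⟨_, hp, rfl⟩
      have hz : z ∈ Prod.snd '' R := ⟨_, hp, rfl⟩
      obtain ⟨i, hi, rfl⟩ := hpr1 ▸ hx
      exact ⟨i, hi, ⟨hx, hz⟩, le_rfl, (hy i hi).2.2 z (hpr2 ▸ hz) hp⟩
    · rintro ⟨i, hi, ⟨hx, hz⟩, hxi, hyz⟩
      exact hR.mem_of_le_of_le hbt (hy i hi).2.1 hx hz hxi hyz
end

section
/- Let n ≥ 1 and let PŁ_k = {0, ℓ, 2ℓ, …, n} (where n = k·ℓ) and PŁ_{k'} be subalgebras of PŁ_n; set S = PŁ_k × PŁ_{k'}. Let y_0 ≤ y_1 ≤ … ≤ y_k be an increasing sequence of elements of PŁ_{k'} with y_0 = 0, y_k = n, and iℓ ≤ y_i for all i = 1, …, k−1, and set R = ⋃_{i=0}^{k} C_{(iℓ, y_i),S}. Then R is a subalgebra of PŁ_n × PŁ_n if and only if for all i, j ∈ {1, …, k−1}, both (iℓ, y_i) ⊙ (jℓ, y_j) ∈ R and (iℓ, y_i) ⊕ (jℓ, y_j) ∈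 R, where ⊙ and ⊕ are applied componentwise. -/
/-- a union of rectangles `⋃ᵢ C_{(iℓ, yᵢ), S}` determined by an increasing
sequence `y₀ = 0 ≤ y₁ ≤ … ≤ y_k = n` in `PŁ_{k'}` with `iℓ ≤ yᵢ` is a subalgebra of
`PŁ_n × PŁ_n` iff the `corner elements' are closed under `⊙` and `⊕`. -/
theorem union_of_rectangles_subalgebra_iff (n : ℕ) (hn : 1 ≤ n) (k ℓ : ℕ)
    (hkl : n = k * ℓ)
    (L' : Set ℕ) (hL' : IsSubalg n L')
    (y : ℕ → ℕ)
    (hymem : ∀ i ≤ k, y i ∈ L')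
    (hymono : ∀ i j : ℕ, i ≤ j → j ≤ k → y i ≤ y j)
    (hy0 : y 0 = 0) (hyk : y k = n)
    (hyi : ∀ i : ℕ, 1 ≤ i → i ≤ k - 1 → i * ℓ ≤ y i)
    (R : Set (ℕ × ℕ))
    (hRdef : R = {p : ℕ × ℕ | ∃ i ≤ k,
      p ∈ ({m : ℕ | ∃ i' ≤ k, m = i' * ℓ} ×ˢ L') ∧ p.1 ≤ i * ℓ ∧ y i ≤ p.2}) :
    IsSubalgPair n R ↔
      ∀ i j : ℕ, 1 ≤ i → i ≤ k - 1 → 1 ≤ j → j ≤ k - 1 →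
        (plOdot n (i * ℓ) (j * ℓ), plOdot n (y i) (y j)) ∈ R ∧
        (plOplus n (i * ℓ) (j * ℓ), plOplus n (y i) (y j)) ∈ R := by
  obtain ⟨hLn, hL0, hLtop, hLmin, hLmax, hLodot, hLoplus⟩ := hL'
  have hℓ : 0 < ℓ := Nat.pos_of_ne_zero fun h => by simp [h] at hkl; omega
  have hmem : ∀ a b : ℕ, (a * ℓ, b) ∈ R ↔ a ≤ k ∧ b ∈ L' ∧ y a ≤ b := by
    intro a b
    rw [hRdef]
    constructor
    · rintro ⟨i, hi, ⟨-, hb⟩, ha, hyb⟩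
      have hai : a ≤ i := Nat.le_of_mul_le_mul_right ha hℓ
      exact ⟨hai.trans hi, hb, (hymono a i hai hi).trans hyb⟩
    · rintro ⟨ha, hb, hyb⟩
      exact ⟨a, ha, ⟨⟨a, ha, rfl⟩, hb⟩, le_rfl, hyb⟩
  have hform : ∀ p ∈ R, ∃ a b : ℕ, p = (a * ℓ, b) := by
    rintro ⟨m, b⟩ hp
    rw [hRdef] at hp
    obtain ⟨-, -, ⟨⟨a, -, rfl⟩, -⟩, -⟩ := hp
    exact ⟨a, b, rfl⟩
  have hodot : ∀ a c : ℕ, plOdot n (a * ℓ) (c * ℓ) = (a + c - k) * ℓ := fun a c => by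
    rw [plOdot, hkl, Nat.sub_mul, Nat.add_mul]
  have hoplus : ∀ a c : ℕ, plOplus n (a * ℓ) (c * ℓ) = min k (a + c) * ℓ := fun a c => by
    rw [plOplus, hkl, ← Nat.add_mul, Nat.mul_min_mul_right]
  constructor
  · rintro ⟨-, -, -, -, -, hRodot, hRoplus⟩ i j _ hi _ hj
    have hi' : (i * ℓ, y i) ∈ R :=
      (hmem _ _).2 ⟨by omega, hymem i (by omega), le_rfl⟩
    have hj' : (j * ℓ, y j) ∈ R :=
      (hmem _ _).2 ⟨by omega, hymem j (by omega), le_rfl⟩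
    exact ⟨hRodot _ hi' _ hj', hRoplus _ hi' _ hj'⟩
  · intro H
    have hRodot : ∀ a c b d : ℕ, a ≤ k → c ≤ k → b ≤ n → d ≤ n → y a ≤ b → y c ≤ d →
        y (a + c - k) ≤ b + d - n := by
      intro a c b d ha hc hb hd hab hcd
      rcases Nat.le_total (a + c) k with h | h
      · simp [Nat.sub_eq_zero_of_le h, hy0]
      rcases ha.eq_or_lt with rfl | ha
      · rw [Nat.add_sub_cancel_left]; omega
      rcases hc.eq_or_lt with rfl | hc
      · rw [Nat.add_sub_cancel]; omega
      have := (H a c (by omega) (by omega) (by omega) (by omega)).1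
      rw [hodot, hmem, plOdot] at this
      omega
    have hRoplus : ∀ a c b d : ℕ, a ≤ k → c ≤ k → b ≤ n → d ≤ n → y a ≤ b → y c ≤ d →
        y (min k (a + c)) ≤ min n (b + d) := by
      intro a c b d ha hc hb hd hab hcd
      rcases ha.eq_or_lt with rfl | ha
      · rw [min_eq_left (Nat.le_add_right _ _)]; omega
      rcases hc.eq_or_lt with rfl | hc
      · rw [min_eq_left (Nat.le_add_left _ _)]; omega
      rcases Nat.eq_zero_or_pos a with rfl | ha0
      · rw [Nat.zero_add, min_eq_right hc.le]; omega
      rcases Nat.eq_zero_or_pos c with rfl | hc0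
      · rw [Nat.add_zero, min_eq_right ha.le]; omega
      have := (H a c ha0 (by omega) hc0 (by omega)).2
      rw [hoplus, hmem, plOplus] at this
      omega
    have hbinary : ∀ f g : ℕ → ℕ → ℕ,
        (∀ a b c d, (a * ℓ, b) ∈ R → (c * ℓ, d) ∈ R → (f (a * ℓ) (c * ℓ), g b d) ∈ R) →
        ∀ p ∈ R, ∀ q ∈ R, (f p.1 q.1, g p.2 q.2) ∈ R := by
      intro f g h p hp q hq
      obtain ⟨a, b, rfl⟩ := hform p hp
      obtain ⟨c, d, rfl⟩ := hform q hq
      exact h a b c d hp hq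
    refine ⟨?_, ?_, ?_, hbinary _ _ ?_, hbinary _ _ ?_, hbinary _ _ ?_, hbinary _ _ ?_⟩
    · intro p hp
      obtain ⟨a, b, rfl⟩ := hform p hp
      obtain ⟨ha, hb, -⟩ := (hmem a b).1 hp
      exact ⟨hkl ▸ Nat.mul_le_mul_right ℓ ha, hLn b hb⟩
    · simpa using (hmem 0 0).2 ⟨Nat.zero_le k, hL0, hy0.le⟩
    · simpa [← hkl] using (hmem k n).2 ⟨le_rfl, hLtop, hyk.le⟩
    all_goals
      intro a b c d hp hq
      obtain ⟨ha, hb, hab⟩ := (hmem a b).1 hp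
      obtain ⟨hc, hd, hcd⟩ := (hmem c d).1 hq
    · rw [Nat.mul_min_mul_right, hmem]
      exact ⟨by omega, hLmin b hb d hd,
        le_min ((hymono _ a (min_le_left a c) ha).trans hab)
          ((hymono _ c (min_le_right a c) hc).trans hcd)⟩
    · rw [Nat.mul_max_mul_right, hmem]
      refine ⟨by omega, hLmax b hb d hd, ?_⟩
      rcases le_total a c with h | h
      · rw [max_eq_right h]; omega
      · rw [max_eq_left h]; omega
    · rw [hodot, hmem]
      exact ⟨by omega, hLodot b hb d hd,
        hRodot a c b d ha hc (hLn b hb) (hLn d hd) hab hcd⟩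
    · rw [hoplus, hmem]
      exact ⟨by omega, hLoplus b hb d hd,
        hRoplus a c b d ha hc (hLn b hb) (hLn d hd) hab hcd⟩
end

section
/- Let n ≥ 1 and let R be a subalgebra of PŁ_n × PŁ_n with R ⊆ ≤, containing some pair (x,y) with x ≠ y (i.e., R is not the diagonal of a subalgebra of PŁ_n), and put S = pr₁(R) × pr₂(R). Then there exists a subalgebra R̄ of PŁ_n × PŁ_n with ⊲ ⊆ R̄ ⊆ ≤ such that R = R̄ ∩ S. -/
theorem IsSubalgPair.zero_top_mem_of_zero_mem {n : ℕ} {R : Set (ℕ × ℕ)}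
    (hR : IsSubalgPair n R) (z : ℕ) (hz : 0 < z) (h : (0, z) ∈ R) : (0, n) ∈ R := by
  have hzn : z ≤ n := (hR.1 _ h).2
  obtain rfl | hlt := hzn.eq_or_lt
  · exact h
  · have h2 := hR.2.2.2.2.2.2 _ h _ h
    have e : plOplus n 0 0 = 0 := by simp [plOplus]
    have hz2 : z < plOplus n z z := by simp only [plOplus]; omega
    rw [e] at h2
    exact hR.zero_top_mem_of_zero_mem (plOplus n z z) (hz.trans hz2) h2
termination_by n - z

/-- A subalgebra containing a pair strictly above the diagonal contains `(0, n)`: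
doubling with `⊕` or `⊙` separates the two coordinates. -/
theorem IsSubalgPair.zero_top_mem {n : ℕ} {R : Set (ℕ × ℕ)}
    (hR : IsSubalgPair n R) (x y : ℕ) (hxy : x < y) (h : (x, y) ∈ R) : (0, n) ∈ R := by
  have hyn : y ≤ n := (hR.1 _ h).2
  have hdot := hR.2.2.2.2.2.1 _ h _ h
  have hplus := hR.2.2.2.2.2.2 _ h _ h
  simp only [plOdot, plOplus] at hdot hplus
  by_cases hx : n ≤ x + x
  · exact hR.zero_top_mem _ _ (by omega) hdot
  · by_cases hy : y + y ≤ n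
    · exact hR.zero_top_mem _ _ (by omega) hplus
    · rw [Nat.sub_eq_zero_of_le (by omega : x + x ≤ n)] at hdot
      exact hR.zero_top_mem_of_zero_mem _ (by omega) hdot
termination_by n - (y - x)

/-- The pairs lying left of and above a member of a subalgebra form a subalgebra. -/
theorem IsSubalgPair.weakening {n : ℕ} {R : Set (ℕ × ℕ)} (hR : IsSubalgPair n R) :
    IsSubalgPair n {p : ℕ × ℕ | p.2 ≤ n ∧ ∃ q ∈ R, p.1 ≤ q.1 ∧ q.2 ≤ p.2} := by
  obtain ⟨hb, h0, h1, hmin, hmax, hdot, hplus⟩ := hR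
  refine ⟨?_, ⟨Nat.zero_le _, _, h0, le_rfl, le_rfl⟩, ⟨le_rfl, _, h1, le_rfl, le_rfl⟩,
    ?_, ?_, ?_, ?_⟩
  · rintro p ⟨hp, q, hq, hpq, -⟩
    exact ⟨hpq.trans (hb q hq).1, hp⟩
  · rintro p ⟨hp, q, hq, h₁, h₂⟩ p' ⟨hp', q', hq', h₁', h₂'⟩
    exact ⟨by dsimp only; omega, _, hmin q hq q' hq', by dsimp only; omega, by dsimp only; omega⟩
  · rintro p ⟨hp, q, hq, h₁, h₂⟩ p' ⟨hp', q', hq', h₁', h₂'⟩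
    exact ⟨by dsimp only; omega, _, hmax q hq q' hq', by dsimp only; omega, by dsimp only; omega⟩
  · rintro p ⟨hp, q, hq, h₁, h₂⟩ p' ⟨hp', q', hq', h₁', h₂'⟩
    exact ⟨by simp only [plOdot]; omega, _, hdot q hq q' hq',
      by simp only [plOdot]; omega, by simp only [plOdot]; omega⟩
  · rintro p ⟨hp, q, hq, h₁, h₂⟩ p' ⟨hp', q', hq', h₁', h₂'⟩
    exact ⟨by simp only [plOplus]; omega, _, hplus q hq q' hq',
      by simp only [plOplus]; omega, by simp only [plOplus]; omega⟩

/-- every non-diagonal subalgebra `R ⊆ ≤` of `PŁ_n × PŁ_n` is the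
intersection of `S = pr₁(R) × pr₂(R)` with a subalgebra `R̄` satisfying `⊲ ⊆ R̄ ⊆ ≤`. -/
theorem subdirect_products_suffice (n : ℕ) (hn : 1 ≤ n)
    (R : Set (ℕ × ℕ)) (hR : IsSubalgPair n R)
    (hle : R ⊆ {p : ℕ × ℕ | p.1 ≤ p.2})
    (hnd : ∃ p ∈ R, p.1 ≠ p.2) :
    ∃ Rbar : Set (ℕ × ℕ), IsSubalgPair n Rbar ∧
      {p : ℕ × ℕ | p.1 ≤ n ∧ p.2 ≤ n ∧ (p.1 = 0 ∨ p.2 = n)} ⊆ Rbar ∧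
      Rbar ⊆ {p : ℕ × ℕ | p.1 ≤ p.2} ∧
      R = Rbar ∩ ((Prod.fst '' R) ×ˢ (Prod.snd '' R)) := by
  obtain ⟨⟨x, y⟩, hxy, hne⟩ := hnd
  have h0n : (0, n) ∈ R := hR.zero_top_mem x y (lt_of_le_of_ne (hle hxy) hne) hxy
  refine ⟨_, hR.weakening, ?_, ?_, ?_⟩
  · rintro ⟨a, b⟩ ⟨ha, hb, h | h⟩
    · exact ⟨hb, _, hR.2.1, h.le, Nat.zero_le _⟩
    · exact ⟨hb, _, hR.2.2.1, ha, h.ge⟩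
  · rintro p ⟨-, q, hq, h₁, h₂⟩
    exact h₁.trans ((hle hq).trans h₂)
  · ext ⟨a, b⟩
    constructor
    · intro h
      exact ⟨⟨(hR.1 _ h).2, _, h, le_rfl, le_rfl⟩, ⟨_, h, rfl⟩, ⟨_, h, rfl⟩⟩
    · rintro ⟨⟨-, ⟨u, v⟩, huv, hau, hvb⟩, ⟨⟨a', c⟩, hac, rfl⟩, ⟨⟨d, b'⟩, hdb, rfl⟩⟩
      obtain ⟨hb, -, -, hmin, hmax, -, -⟩ := hR
      have hcn := (hb _ hac).2
      have hbn := (hb _ hdb).2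
      have hvn := (hb _ huv).2
      have key := hmax _ (hmin _ (hmax _ hac _ h0n) _ huv) _ (hmin _ hdb _ h0n)
      dsimp only at hau hvb hcn hbn hvn key ⊢
      convert key using 2 <;> omega
end

section
/- Let n ≥ 1 and let PŁ_k = {0, ℓ, 2ℓ, …, n} (where n = k·ℓ) be a subalgebra of PŁ_n. Then there exists a subalgebra R of PŁ_n × PŁ_n with ⊲ ⊆ R ⊆ ≤ such that R ∩ Δ = {(x,x) : x ∈ PŁ_k}, where Δ = {(x,x) : x ∈ {0,…,n}} is the diagonal of PŁ_n. -/
/-- The multiples `{0, ℓ, 2ℓ, …, kℓ}` form a subalgebra of `PŁ_{kℓ}`. -/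
theorem isSubalg_multiples (k ℓ : ℕ) : IsSubalg (k * ℓ) {x | ∃ i ≤ k, x = i * ℓ} := by
  refine ⟨?_, ⟨0, by simp⟩, ⟨k, le_rfl, rfl⟩, ?_, ?_, ?_, ?_⟩
  · rintro _ ⟨i, hi, rfl⟩
    exact Nat.mul_le_mul_right ℓ hi
  all_goals rintro _ ⟨i, hi, rfl⟩ _ ⟨j, hj, rfl⟩
  · exact ⟨min i j, by omega, (Nat.mul_min_mul_right i j ℓ)⟩
  · exact ⟨max i j, by omega, (Nat.mul_max_mul_right i j ℓ)⟩
  · exact ⟨i + j - k, by omega, by rw [plOdot, Nat.sub_mul, Nat.add_mul]⟩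
  · exact ⟨min k (i + j), by omega, by rw [plOplus, ← Nat.add_mul, Nat.mul_min_mul_right]⟩

/-- The pairs `(x, y)` separated by an element of `L`, that is, with `x ≤ m ≤ y` for some
`m ∈ L`. -/
def separatedPairs (n : ℕ) (L : Set ℕ) : Set (ℕ × ℕ) :=
  {p | p.2 ≤ n ∧ ∃ m ∈ L, p.1 ≤ m ∧ m ≤ p.2}

theorem IsSubalg.isSubalgPair_separatedPairs {n : ℕ} {L : Set ℕ} (hL : IsSubalg n L) :
    IsSubalgPair n (separatedPairs n L) := by
  obtain ⟨-, h0, hn, hmin, hmax, hodot, hoplus⟩ := hL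
  refine ⟨?_, ⟨Nat.zero_le n, 0, h0, le_rfl, le_rfl⟩, ⟨le_rfl, n, hn, le_rfl, le_rfl⟩,
    ?_, ?_, ?_, ?_⟩
  · rintro p ⟨hp, m, -, h₁, h₂⟩
    omega
  all_goals
    rintro ⟨x, y⟩ ⟨hy, m, hm, hxm, hmy⟩ ⟨x', y'⟩ ⟨hy', m', hm', hxm', hmy'⟩
    dsimp only at hy hxm hmy hy' hxm' hmy'
  · exact ⟨by dsimp only; omega, _, hmin m hm m' hm', by dsimp only; omega, by dsimp only; omega⟩
  · exact ⟨by dsimp only; omega, _, hmax m hm m' hm', by dsimp only; omega, by dsimp only; omega⟩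
  · exact ⟨by dsimp only [plOdot]; omega, _, hodot m hm m' hm', by dsimp only [plOdot]; omega,
      by dsimp only [plOdot]; omega⟩
  · exact ⟨by dsimp only [plOplus]; omega, _, hoplus m hm m' hm', by dsimp only [plOplus]; omega,
      by dsimp only [plOplus]; omega⟩

/-- for every subalgebra `PŁ_k ⊆ PŁ_n` there is a subalgebra `R` of
`PŁ_n × PŁ_n` with `⊲ ⊆ R ⊆ ≤` whose intersection with the diagonal of `PŁ_n`
is the diagonal of `PŁ_k`. -/
theorem subdirect_products_entail_subalgebras (n : ℕ) (hn : 1 ≤ n) (k ℓ : ℕ)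
    (hkl : n = k * ℓ) :
    ∃ R : Set (ℕ × ℕ), IsSubalgPair n R ∧
      {p : ℕ × ℕ | p.1 ≤ n ∧ p.2 ≤ n ∧ (p.1 = 0 ∨ p.2 = n)} ⊆ R ∧
      R ⊆ {p : ℕ × ℕ | p.1 ≤ p.2} ∧
      R ∩ {p : ℕ × ℕ | p.1 = p.2} = {p : ℕ × ℕ | ∃ i ≤ k, p = (i * ℓ, i * ℓ)} := by
  have hL : IsSubalg n {x | ∃ i ≤ k, x = i * ℓ} := hkl ▸ isSubalg_multiples k ℓ
  refine ⟨separatedPairs n {x | ∃ i ≤ k, x = i * ℓ}, hL.isSubalgPair_separatedPairs, ?_, ?_, ?_⟩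
  · rintro ⟨x, y⟩ ⟨hx, hy, h | h⟩
    · exact ⟨hy, 0, hL.2.1, h.le, Nat.zero_le y⟩
    · exact ⟨hy, n, hL.2.2.1, hx, h.ge⟩
  · rintro p ⟨-, m, -, h₁, h₂⟩
    exact h₁.trans h₂
  · ext ⟨x, y⟩
    constructor
    · rintro ⟨⟨-, m, ⟨i, hi, rfl⟩, h₁, h₂⟩, h⟩
      change x = y at h
      dsimp only at h₁ h₂
      exact ⟨i, hi, Prod.ext (by dsimp only; omega) (by dsimp only; omega)⟩
    · rintro ⟨i, hi, h⟩
      obtain ⟨rfl, rfl⟩ := Prod.mk.inj h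
      exact ⟨⟨hL.1 _ ⟨i, hi, rfl⟩, _, ⟨i, hi, rfl⟩, le_rfl, le_rfl⟩, rfl⟩
end

section
/- Let n ≥ 1 and d ∈ {0, 1, …, n}. Consider the first-order language consisting of two binary function symbols and two constant symbols, interpreted in PŁ_n as the operations ⊙ and ⊕ and the constants 0 and n respectively. Then there exists a term t in one variable of this language whose interpretation in PŁ_n is exactly the function τ_d; that is, τ_d is term-definable in PŁ_n. -/
/-- Terms in one variable over the language with two binary function symbols
(interpreted as `⊙` and `⊕`) and two constant symbols (interpreted as `0` and `n`). -/
inductive PTerm : Type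
  | var : PTerm
  | zero : PTerm
  | top : PTerm
  | odot : PTerm → PTerm → PTerm
  | oplus : PTerm → PTerm → PTerm

/-- Interpretation of a term in `PŁ_n` at the value `x` of the variable. -/
def PTerm.eval (n x : ℕ) : PTerm → ℕ
  | PTerm.var => x
  | PTerm.zero => 0
  | PTerm.top => n
  | PTerm.odot s t => plOdot n (s.eval n x) (t.eval n x)
  | PTerm.oplus s t => plOplus n (s.eval n x) (t.eval n x)

theorem PTerm.eval_le {n x : ℕ} (hx : x ≤ n) (t : PTerm) : t.eval n x ≤ n := by
  induction t <;> simp only [PTerm.eval, plOdot, plOplus] <;> omega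

/-- The term `t` separates the inputs below `d` from the others: its values are at most `a` on the
former and at least `b` on the latter. -/
def PTerm.Separates (n d a b : ℕ) (t : PTerm) : Prop :=
  ∀ x ≤ n, (x < d → t.eval n x ≤ a) ∧ (d ≤ x → b ≤ t.eval n x)

theorem PTerm.Separates.odot_self {n d a b : ℕ} {t : PTerm} (h : t.Separates n d a b) :
    (PTerm.odot t t).Separates n d (2 * a - n) (2 * b - n) := by
  intro x hx
  have := h x hx
  simp only [PTerm.eval, plOdot]
  omega

theorem PTerm.Separates.oplus_self {n d a b : ℕ} {t : PTerm} (h : t.Separates n d a b) :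
    (PTerm.oplus t t).Separates n d (2 * a) (min n (2 * b)) := by
  intro x hx
  have := h x hx
  simp only [PTerm.eval, plOplus]
  omega

theorem PTerm.Separates.exists_of_lt_top {n d a : ℕ} (ha : a < n) {t : PTerm}
    (h : t.Separates n d a n) : ∃ s : PTerm, s.Separates n d 0 n := by
  induction a using Nat.strong_induction_on generalizing t with
  | _ a ih =>
    rcases Nat.eq_zero_or_pos a with rfl | hpos
    · exact ⟨t, h⟩
    · have h' := h.odot_self
      rw [show 2 * n - n = n by omega] at h'
      exact ih (2 * a - n) (by omega) (by omega) h'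

theorem PTerm.Separates.exists_of_lt {n d a b : ℕ} (hab : a < b) (hb : b ≤ n) {t : PTerm}
    (h : t.Separates n d a b) : ∃ s : PTerm, s.Separates n d 0 n := by
  induction hk : n - (b - a) using Nat.strong_induction_on generalizing a b t with
  | _ k ih =>
    by_cases hlow : 2 * b ≤ n
    · have h' := h.oplus_self
      rw [min_eq_right hlow] at h'
      exact ih (n - (2 * b - 2 * a)) (by omega) (by omega) hlow h' rfl
    by_cases hhigh : n ≤ 2 * a
    · exact ih (n - (2 * b - n - (2 * a - n))) (by omega) (by omega) (by omega) h.odot_self rfl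
    · have h' := h.oplus_self
      rw [min_eq_left (by omega)] at h'
      exact h'.exists_of_lt_top (by omega)

/-- for every `d ∈ {0,…,n}` the map `τ_d` (with `τ_d x = n` if `d ≤ x`
and `τ_d x = 0` otherwise) is term-definable in `PŁ_n` from `⊙`, `⊕`, `0`, `n`. -/
theorem tau_term_definable (n : ℕ) (hn : 1 ≤ n) (d : ℕ) (hd : d ≤ n) :
    ∃ t : PTerm, ∀ x ≤ n, t.eval n x = (if d ≤ x then n else 0) := by
  rcases Nat.eq_zero_or_pos d with rfl | hpos
  · exact ⟨PTerm.top, fun x _ => by simp [PTerm.eval]⟩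
  · have hvar : PTerm.var.Separates n d (d - 1) d := by
      intro x _
      simp only [PTerm.eval]
      omega
    obtain ⟨t, ht⟩ := hvar.exists_of_lt (by omega) hd
    refine ⟨t, fun x hx => ?_⟩
    have hsep := ht x hx
    have hle := t.eval_le hx
    split_ifs <;> omega
end

section
/- Let n ≥ 1, let I be a set, and let A be a subalgebra of PŁ_n^I that is closed under τ_d applied pointwise for every d ∈ {0,…,n}. Let u, u' : A → {0,…,n} be homomorphisms to PŁ_n (preserving the constant functions 0 and n and the operations ∧, ∨, ⊙, ⊕) which moreover satisfy u(τ_d ∘ a) = τ_d(u(a)) and u'(τ_d ∘ a) = τ_d(u'(a)) for all d and all a ∈ A (this is automatic since each τ_d is term-definable from ⊙, ⊕, 0, n). If u and u' agree on the distributive skeleton S(A) = {a ∈ A : a ⊕ a = a}, then u = u'. -/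
/-- `τ_d : {0,…,n} → {0,…,n}` sends `x` to `n` if `d ≤ x` and to `0` otherwise. -/
def tau (n d x : ℕ) : ℕ := if d ≤ x then n else 0

/-- `A` is a subalgebra of the power `PŁ_nᴵ`: a set of functions `I → {0,…,n}`
containing the constant functions `0` and `n` and closed under pointwise
`∧, ∨, ⊙, ⊕`. -/
def IsSubalgPow (n : ℕ) {I : Type*} (A : Set (I → ℕ)) : Prop :=
  (∀ a ∈ A, ∀ i, a i ≤ n) ∧ (fun _ => 0) ∈ A ∧ (fun _ => n) ∈ A ∧
  (∀ a ∈ A, ∀ b ∈ A, (fun i => min (a i) (b i)) ∈ A) ∧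
  (∀ a ∈ A, ∀ b ∈ A, (fun i => max (a i) (b i)) ∈ A) ∧
  (∀ a ∈ A, ∀ b ∈ A, (fun i => plOdot n (a i) (b i)) ∈ A) ∧
  (∀ a ∈ A, ∀ b ∈ A, (fun i => plOplus n (a i) (b i)) ∈ A)

/-- `A` is closed under `τ_d` applied pointwise, for every `d ∈ {0,…,n}`. -/
def ClosedUnderTau (n : ℕ) {I : Type*} (A : Set (I → ℕ)) : Prop :=
  ∀ a ∈ A, ∀ d ≤ n, (fun i => tau n d (a i)) ∈ A

/-- Membership in the distributive skeleton `S(A) = {a ∈ A : a ⊕ a = a}`. -/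
def InSkeleton (n : ℕ) {I : Type*} (A : Set (I → ℕ)) (a : I → ℕ) : Prop :=
  a ∈ A ∧ (fun i => plOplus n (a i) (a i)) = a

/-- two homomorphisms `A → PŁ_n` (compatible with the `τ_d`) which
agree on the distributive skeleton `S(A)` are equal. -/
theorem homs_agreeing_on_skeleton_equal (n : ℕ) (hn : 1 ≤ n) {I : Type*}
    (A : Set (I → ℕ)) (hA : IsSubalgPow n A) (hAtau : ClosedUnderTau n A)
    (u u' : (I → ℕ) → ℕ)
    (hur : ∀ a ∈ A, u a ≤ n) (hur' : ∀ a ∈ A, u' a ≤ n)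
    (hu0 : u (fun _ => 0) = 0) (hu0' : u' (fun _ => 0) = 0)
    (huN : u (fun _ => n) = n) (huN' : u' (fun _ => n) = n)
    (humin : ∀ a ∈ A, ∀ b ∈ A, u (fun i => min (a i) (b i)) = min (u a) (u b))
    (humin' : ∀ a ∈ A, ∀ b ∈ A, u' (fun i => min (a i) (b i)) = min (u' a) (u' b))
    (humax : ∀ a ∈ A, ∀ b ∈ A, u (fun i => max (a i) (b i)) = max (u a) (u b))
    (humax' : ∀ a ∈ A, ∀ b ∈ A, u' (fun i => max (a i) (b i)) = max (u' a) (u' b))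
    (huodot : ∀ a ∈ A, ∀ b ∈ A,
      u (fun i => plOdot n (a i) (b i)) = plOdot n (u a) (u b))
    (huodot' : ∀ a ∈ A, ∀ b ∈ A,
      u' (fun i => plOdot n (a i) (b i)) = plOdot n (u' a) (u' b))
    (huoplus : ∀ a ∈ A, ∀ b ∈ A,
      u (fun i => plOplus n (a i) (b i)) = plOplus n (u a) (u b))
    (huoplus' : ∀ a ∈ A, ∀ b ∈ A,
      u' (fun i => plOplus n (a i) (b i)) = plOplus n (u' a) (u' b))
    (hutau : ∀ a ∈ A, ∀ d ≤ n, u (fun i => tau n d (a i)) = tau n d (u a))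
    (hutau' : ∀ a ∈ A, ∀ d ≤ n, u' (fun i => tau n d (a i)) = tau n d (u' a))
    (hagree : ∀ a, InSkeleton n A a → u a = u' a) :
    ∀ a ∈ A, u a = u' a := by
  have skel : ∀ a ∈ A, ∀ d ≤ n, tau n d (u a) = tau n d (u' a) := by
    intro a ha d hd
    rw [← hutau a ha d hd, ← hutau' a ha d hd]
    refine hagree _ ⟨hAtau a ha d hd, ?_⟩
    funext i
    simp only [plOplus, tau]
    split_ifs <;> omega
  have le_of_tau_eq : ∀ x y, tau n x x = tau n x y → x ≤ y := by
    intro x y h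
    simp only [tau, le_refl, if_true] at h
    split_ifs at h <;> omega
  intro a ha
  exact le_antisymm
    (le_of_tau_eq _ _ (skel a ha _ (hur a ha)))
    (le_of_tau_eq _ _ (skel a ha _ (hur' a ha)).symm)
end

section
/- Let n ≥ 1, let I be a set, and let A be a subalgebra of PŁ_n^I that is closed under τ_d applied pointwise for every d ∈ {0,…,n}. Let p : S(A) → {0,1} be a bounded lattice homomorphism from the distributive skeleton S(A) = {a ∈ A : a ⊕ a = a} to the two-element lattice (p sends the constant function 0 to 0, the constant function n to 1, and preserves ∧ and ∨). Define u_p : A → {0,…,n} by u_p(a) = max{d ∈ {0,…,n} : p(τ_d ∘ a) = 1} (note τ_d ∘ a ∈ S(A), and the set is nonempty since p(τ_0 ∘ a) = 1). Then u_p is a homomorphism A → PŁ_n (it sends the constant functions 0 and n to 0 and n respectively and satisfies u_p(a ∗ b) = u_p(a) ∗ u_p(b) for every ∗ ∈ {∧, ∨, ⊙, ⊕}), and its restriction to S(A) equals p, i.e., for a ∈ S(A), u_p(a) = n if p(a) = 1 and u_p(a) = 0 if p(a) = 0. -/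
/-- `p` is a bounded lattice homomorphism from the distributive skeleton `S(A)`
to the two-element lattice `{0,1}` (modelled as `Bool`). -/
def IsSkeletonHom (n : ℕ) {I : Type*} (A : Set (I → ℕ)) (p : (I → ℕ) → Bool) : Prop :=
  p (fun _ => 0) = false ∧ p (fun _ => n) = true ∧
  (∀ a b, InSkeleton n A a → InSkeleton n A b →
    p (fun i => min (a i) (b i)) = (p a && p b)) ∧
  (∀ a b, InSkeleton n A a → InSkeleton n A b →
    p (fun i => max (a i) (b i)) = (p a || p b))

/-- `u_p(a) = max {d ∈ {0,…,n} : p (τ_d ∘ a) = 1}`. -/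
noncomputable def uP (n : ℕ) {I : Type*} (p : (I → ℕ) → Bool) (a : I → ℕ) : ℕ :=
  sSup {d : ℕ | d ≤ n ∧ p (fun i => tau n d (a i)) = true}

section Skeleton

variable {n : ℕ} {I : Type*} {A : Set (I → ℕ)} {p : (I → ℕ) → Bool}

/-- A member of `A` with values in `{0, n}` belongs to the skeleton. -/
theorem inSkeleton_of_values {a : I → ℕ} (ha : a ∈ A) (h : ∀ i, a i = 0 ∨ a i = n) :
    InSkeleton n A a := by
  refine ⟨ha, funext fun i => ?_⟩
  have := h i
  simp only [plOplus]
  omega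

theorem InSkeleton.values {a : I → ℕ} (ha : InSkeleton n A a) (i : I) : a i = 0 ∨ a i = n := by
  have := congrFun ha.2 i
  simp only [plOplus] at this
  omega

theorem InSkeleton.min {a b : I → ℕ} (hA : IsSubalgPow n A) (ha : InSkeleton n A a)
    (hb : InSkeleton n A b) : InSkeleton n A (fun i => min (a i) (b i)) := by
  refine inSkeleton_of_values (hA.2.2.2.1 a ha.1 b hb.1) fun i => ?_
  have := ha.values i
  have := hb.values i
  omega

theorem InSkeleton.max {a b : I → ℕ} (hA : IsSubalgPow n A) (ha : InSkeleton n A a)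
    (hb : InSkeleton n A b) : InSkeleton n A (fun i => max (a i) (b i)) := by
  refine inSkeleton_of_values (hA.2.2.2.2.1 a ha.1 b hb.1) fun i => ?_
  have := ha.values i
  have := hb.values i
  omega

/-- `τ_d ∘ a` lies in the skeleton, also for `d > n`, where it is the constant `0`. -/
theorem inSkeleton_tau (hA : IsSubalgPow n A) (hAtau : ClosedUnderTau n A) {a : I → ℕ}
    (ha : a ∈ A) (d : ℕ) : InSkeleton n A (fun i => tau n d (a i)) := by
  refine inSkeleton_of_values ?_ fun i => by unfold tau; split_ifs <;> simp
  by_cases hd : d ≤ n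
  · exact hAtau a ha d hd
  · convert hA.2.1 using 2 with i
    have := hA.1 a ha i
    exact if_neg (by omega)

theorem IsSkeletonHom.mono (hp : IsSkeletonHom n A p) {a b : I → ℕ} (ha : InSkeleton n A a)
    (hb : InSkeleton n A b) (hab : ∀ i, a i ≤ b i) (h : p a = true) : p b = true := by
  have h' := hp.2.2.1 a b ha hb
  rw [show (fun i => min (a i) (b i)) = a from funext fun i => min_eq_left (hab i), h] at h'
  exact h'.symm

theorem bddAbove_tau_levels (n : ℕ) (p : (I → ℕ) → Bool) (a : I → ℕ) :
    BddAbove {d : ℕ | d ≤ n ∧ p (fun i => tau n d (a i)) = true} :=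
  ⟨n, fun _ hd => hd.1⟩

/-- The maximum defining `u_p(a)` is attained. -/
theorem tau_uP_eq_true (hp : IsSkeletonHom n A p) (a : I → ℕ) :
    p (fun i => tau n (uP n p a) (a i)) = true := by
  have hne : {d : ℕ | d ≤ n ∧ p (fun i => tau n d (a i)) = true}.Nonempty :=
    ⟨0, Nat.zero_le n, by simpa [tau] using hp.2.1⟩
  exact (Nat.sSup_mem hne (bddAbove_tau_levels n p a)).2

theorem tau_uP_succ_eq_false (hA : IsSubalgPow n A) (hp : IsSkeletonHom n A p) {a : I → ℕ}
    (ha : a ∈ A) : p (fun i => tau n (uP n p a + 1) (a i)) = false := by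
  by_cases hd : uP n p a + 1 ≤ n
  · by_contra h
    have := le_csSup (bddAbove_tau_levels n p a) ⟨hd, by simpa using h⟩
    change uP n p a + 1 ≤ uP n p a at this
    omega
  · convert hp.1 using 3 with i
    have := hA.1 a ha i
    exact if_neg (by omega)

/-- Any three members of `A` simultaneously attain their `u_p`-values at some coordinate. -/
theorem exists_apply_eq_uP (hA : IsSubalgPow n A) (hAtau : ClosedUnderTau n A)
    (hp : IsSkeletonHom n A p) {a b c : I → ℕ} (ha : a ∈ A) (hb : b ∈ A) (hc : c ∈ A) :
    ∃ i, a i = uP n p a ∧ b i = uP n p b ∧ c i = uP n p c := by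
  by_contra! hne
  have sa := inSkeleton_tau hA hAtau ha
  have sb := inSkeleton_tau hA hAtau hb
  have sc := inSkeleton_tau hA hAtau hc
  have smin := (sa (uP n p a)).min hA ((sb (uP n p b)).min hA (sc (uP n p c)))
  have smax := (sa (uP n p a + 1)).max hA ((sb (uP n p b + 1)).max hA (sc (uP n p c + 1)))
  have hmin := hp.2.2.1 _ _ (sa (uP n p a)) ((sb (uP n p b)).min hA (sc (uP n p c)))
  rw [hp.2.2.1 _ _ (sb _) (sc _), tau_uP_eq_true hp, tau_uP_eq_true hp, tau_uP_eq_true hp] at hmin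
  have hmax := hp.2.2.2 _ _ (sa (uP n p a + 1)) ((sb (uP n p b + 1)).max hA (sc (uP n p c + 1)))
  rw [hp.2.2.2 _ _ (sb _) (sc _), tau_uP_succ_eq_false hA hp ha, tau_uP_succ_eq_false hA hp hb,
    tau_uP_succ_eq_false hA hp hc] at hmax
  refine absurd (hp.mono smin smax (fun i => ?_) hmin) (by simp [hmax])
  have := hne i
  simp only [tau]
  split_ifs <;> omega

end Skeleton

/-- for a bounded lattice homomorphism `p : S(A) → {0,1}`, the map
`u_p(a) = max {d : p(τ_d ∘ a) = 1}` is a homomorphism `A → PŁ_n` whose restriction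
to the skeleton is `p`. -/
theorem skeleton_hom_extends (n : ℕ) (hn : 1 ≤ n) {I : Type*}
    (A : Set (I → ℕ)) (hA : IsSubalgPow n A) (hAtau : ClosedUnderTau n A)
    (p : (I → ℕ) → Bool) (hp : IsSkeletonHom n A p) :
    (∀ a ∈ A, uP n p a ≤ n) ∧
    uP n p (fun _ => 0) = 0 ∧ uP n p (fun _ => n) = n ∧
    (∀ a ∈ A, ∀ b ∈ A,
      uP n p (fun i => min (a i) (b i)) = min (uP n p a) (uP n p b)) ∧
    (∀ a ∈ A, ∀ b ∈ A,
      uP n p (fun i => max (a i) (b i)) = max (uP n p a) (uP n p b)) ∧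
    (∀ a ∈ A, ∀ b ∈ A,
      uP n p (fun i => plOdot n (a i) (b i)) = plOdot n (uP n p a) (uP n p b)) ∧
    (∀ a ∈ A, ∀ b ∈ A,
      uP n p (fun i => plOplus n (a i) (b i)) = plOplus n (uP n p a) (uP n p b)) ∧
    (∀ a, InSkeleton n A a →
      (p a = true → uP n p a = n) ∧ (p a = false → uP n p a = 0)) := by
  have key := fun {a b c : I → ℕ} => exists_apply_eq_uP (a := a) (b := b) (c := c) hA hAtau hp
  have bound : ∀ a ∈ A, uP n p a ≤ n := fun a ha => by
    obtain ⟨i, hi, -⟩ := key ha ha ha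
    exact hi ▸ hA.1 a ha i
  have ⟨_, h0, h1, hmin, hmax, hodot, hoplus⟩ := hA
  refine ⟨bound, ?_, ?_, fun a ha b hb => ?_, fun a ha b hb => ?_, fun a ha b hb => ?_,
    fun a ha b hb => ?_, fun a ha => ⟨fun h => ?_, fun h => ?_⟩⟩
  · obtain ⟨i, hi, -⟩ := key h0 h0 h0
    exact hi.symm
  · obtain ⟨i, hi, -⟩ := key h1 h1 h1
    exact hi.symm
  · obtain ⟨i, hai, hbi, hci⟩ := key ha hb (hmin a ha b hb)
    rw [← hci, hai, hbi]
  · obtain ⟨i, hai, hbi, hci⟩ := key ha hb (hmax a ha b hb)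
    rw [← hci, hai, hbi]
  · obtain ⟨i, hai, hbi, hci⟩ := key ha hb (hodot a ha b hb)
    rw [← hci, hai, hbi]
  · obtain ⟨i, hai, hbi, hci⟩ := key ha hb (hoplus a ha b hb)
    rw [← hci, hai, hbi]
  all_goals
    have htau : (fun i => tau n n (a i)) = a := funext fun i => by
      have := ha.values i
      simp only [tau]
      split_ifs <;> omega
  · exact le_antisymm (bound a ha.1) (le_csSup (bddAbove_tau_levels n p a) ⟨le_rfl, by rwa [htau]⟩)
  · obtain ⟨i, hi, -⟩ := key ha.1 ha.1 ha.1
    refine hi ▸ (ha.values i).resolve_right fun hn' => ?_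
    have := tau_uP_eq_true hp a
    rw [← hi, hn', htau, h] at this
    exact Bool.noConfusion this
end

section
/- Let X be a compact Hausdorff totally disconnected space equipped with a partial order ≤ making it a Priestley space (i.e., whenever x ≰ y there is a clopen up-set containing x but not y) and with a binary relation ⊲ᵡ on X satisfying: x ⊲ᵡ y implies x ≤ y. Let PŁ_2 = {0,1,2} carry the usual order and the relation ⊲ = {(a,b) : a = 0 or b = 2}. If x ≰ y in X, then there exists a map φ : X → {0,1,2} which is continuous (with {0,1,2} discrete), order-preserving, satisfies φ(z) ⊲ φ(z') whenever z ⊲ᵡ z', and has φ(x) ≰ φ(y). -/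
/-- in a Priestley space `X` with an extra binary relation `⊲ᵡ ⊆ ≤`,
whenever `x ≰ y` there is a continuous order-preserving map `φ : X → PŁ_2 = {0,1,2}`
preserving `⊲` (where `a ⊲ b` iff `a = 0` or `b = 2`) with `φ x ≰ φ y`. -/
theorem separation_order (X : Type*) [TopologicalSpace X] [CompactSpace X]
    [T2Space X] [TotallyDisconnectedSpace X] [PartialOrder X]
    (hPriestley : ∀ x y : X, ¬ x ≤ y →
      ∃ U : Set X, IsClopen U ∧ IsUpperSet U ∧ x ∈ U ∧ y ∉ U)
    (tr : X → X → Prop) (htr : ∀ x y : X, tr x y → x ≤ y)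
    (x y : X) (hxy : ¬ x ≤ y) :
    ∃ φ : X → ℕ, (∀ z, φ z ≤ 2) ∧ Continuous φ ∧ Monotone φ ∧
      (∀ z z' : X, tr z z' → (φ z = 0 ∨ φ z' = 2)) ∧
      ¬ φ x ≤ φ y := by
  obtain ⟨U, hU, hup, hx, hy⟩ := hPriestley x y hxy
  refine ⟨U.indicator fun _ => 2, fun z => ?_, ?_, fun a b hab => ?_, fun a b hab => ?_, ?_⟩
  · by_cases hz : z ∈ U <;> simp [hz]
  · exact continuous_const.indicator (by simp [hU.frontier_eq])
  · by_cases ha : a ∈ U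
    · simp [ha, hup hab ha]
    · simp [ha]
  · by_cases ha : a ∈ U
    · simp [hup (htr a b hab) ha]
    · simp [ha]
  · simp [hx, hy]
end

section
/- Let X be a compact Hausdorff totally disconnected space equipped with a partial order ≤ making it a Priestley space (i.e., whenever x ≰ y there is a clopen up-set containing x but not y) and with a binary relation ⊲ᵡ on X satisfying: x ⊲ᵡ y implies x ≤ y. Let PŁ_2 = {0,1,2} carry the usual order and the relation ⊲ = {(a,b) : a = 0 or b = 2}. Suppose x, y ∈ X satisfy ¬(x ⊲ᵡ y) and x ≤ y, and suppose there exist a clopen up-set U and a clopen down-set D in X such that x ∉ D, y ∉ U, and for all z, z' ∈ X, z ⊲ᵡ z' implies z ∈ D or z' ∈ U. Then there exists a map φ : X → {0,1,2} which is continuous (with {0,1,2} discrete), order-preserving, satisfies φ(z) ⊲ φ(z') whenever z ⊲ᵡ z', and has φ(x) = φ(y) = 1; in particular ¬(φ(x) ⊲ φ(y)). -/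
/-- in a Priestley space `X` with an extra binary relation `⊲ᵡ ⊆ ≤`,
if `¬(x ⊲ᵡ y)` and `x ≤ y`, and there are a clopen up-set `U` and a clopen down-set
`D` with `x ∉ D`, `y ∉ U`, and `z ⊲ᵡ z' → z ∈ D ∨ z' ∈ U`, then there is a continuous
order-preserving map `φ : X → PŁ_2 = {0,1,2}` preserving `⊲` (where `a ⊲ b` iff
`a = 0` or `b = 2`) with `φ x = φ y = 1`, in particular `¬(φ x ⊲ φ y)`. -/
theorem separation_triangle (X : Type*) [TopologicalSpace X] [CompactSpace X]
    [T2Space X] [TotallyDisconnectedSpace X] [PartialOrder X]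
    (hPriestley : ∀ x y : X, ¬ x ≤ y →
      ∃ U : Set X, IsClopen U ∧ IsUpperSet U ∧ x ∈ U ∧ y ∉ U)
    (tr : X → X → Prop) (htr : ∀ x y : X, tr x y → x ≤ y)
    (x y : X) (hxy1 : ¬ tr x y) (hxy2 : x ≤ y)
    (U D : Set X) (hU : IsClopen U) (hUup : IsUpperSet U)
    (hD : IsClopen D) (hDdown : IsLowerSet D)
    (hxD : x ∉ D) (hyU : y ∉ U)
    (hsep : ∀ z z' : X, tr z z' → z ∈ D ∨ z' ∈ U) :
    ∃ φ : X → ℕ, (∀ z, φ z ≤ 2) ∧ Continuous φ ∧ Monotone φ ∧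
      (∀ z z' : X, tr z z' → (φ z = 0 ∨ φ z' = 2)) ∧
      φ x = 1 ∧ φ y = 1 ∧ ¬ (φ x = 0 ∨ φ y = 2) := by
  classical
  have hxU : x ∉ U := fun h => hyU (hUup hxy2 h)
  have hyD : y ∉ D := fun h => hxD (hDdown hxy2 h)
  refine ⟨fun z => if z ∈ U then 2 else if z ∈ D then 0 else 1, ?_, ?_, ?_, ?_, ?_, ?_, ?_⟩
  · intro z
    dsimp only
    split_ifs <;> simp
  · refine continuous_const.if ?_ (continuous_const.if ?_ continuous_const)
    · intro a ha
      have ha' : a ∈ frontier U := ha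
      simp [hU.frontier_eq] at ha'
    · intro a ha
      have ha' : a ∈ frontier D := ha
      simp [hD.frontier_eq] at ha'
  · intro a b hab
    have h1 := @hUup a b hab
    have h2 := @hDdown b a hab
    dsimp only
    split_ifs <;> simp_all
  · intro z z' h
    have h1 := @hUup z z' (htr z z' h)
    have h2 := hsep z z' h
    dsimp only
    split_ifs <;> simp_all
  · simp [hxU, hxD]
  · simp [hyU, hyD]
  · simp [hxU, hxD, hyU, hyD]
end
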